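/- Let 0 ≤ m ≤ n be integers. The family {ψ_{k,i} : −n ≤ k ≤ n, 1 ≤ i ≤ N_k} is an orthonormal basis of the N_n^m-dimensional space Π_n^m, and the space-frequency operator has the spectral decomposition P_n^m M P_n^m f = Σ_{k=−n}^n Σ_{i=1}^{N_k} x_{|k|,i} ⟨f, ψ_{k,i}⟩ ψ_{k,i} for every f ∈ L²(S²). -/

import Mathlib

open MeasureTheory Finset

noncomputable section

namespace SFT

/-- The recurrence coefficients `b_l^{(α)}` of the orthonormal ultraspherical polynomials. -/
def b (α : ℝ) : ℕ → ℝ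
  | 0 => Real.sqrt (Real.sqrt Real.pi * Real.Gamma (α + 1) / (2 * Real.Gamma (α + 3 / 2)))
  | l + 1 => Real.sqrt ((((l : ℝ) + 1) * (((l : ℝ) + 1) + 2 * α)) /
      ((2 * ((l : ℝ) + 1) + 2 * α + 1) * (2 * ((l : ℝ) + 1) + 2 * α - 1)))

/-- The associated ultraspherical polynomials: `pA α m l x = p_l^{(α)}(x, m)`.
For `m = 0` these are the orthonormal ultraspherical polynomials `p_l^{(α)}(x)`. -/
def pA (α : ℝ) (m : ℕ) : ℕ → ℝ → ℝ
  | 0, _ => 1 / b α m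
  | 1, x => x * (1 / b α m) / b α (m + 1)
  | l + 2, x => (x * pA α m (l + 1) x - b α (m + l + 1) * pA α m l x) / b α (m + l + 2)

/-- The orthonormal ultraspherical polynomials `p_l^{(α)}(x)`. -/
def p (α : ℝ) (l : ℕ) (x : ℝ) : ℝ := pA α 0 l x

/-- Ultraspherical polynomials with integer index; in particular `p_{-1}^{(α)} = 0`. -/
def pZ (α : ℝ) (l : ℤ) (x : ℝ) : ℝ := if 0 ≤ l then p α l.toNat x else 0

/-- `JE α M i j` is the `(i,j)` entry (`0`-based) of the truncated Jacobi matrix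
`J(α)_L^M` (of any size `L − M + 1`). -/
def JE (α : ℝ) (M : ℕ) (i j : ℕ) : ℝ :=
  if i + 1 = j then b α (M + i + 1) else if j + 1 = i then b α (M + j + 1) else 0

/-- The truncated Jacobi matrix `J(α)_{M+l}^M`, of size `(l+1) × (l+1)`.
In particular `Jt α 0 l` is the Jacobi matrix `J(α)_l`. -/
def Jt (α : ℝ) (M l : ℕ) : Matrix (Fin (l + 1)) (Fin (l + 1)) ℝ :=
  fun i j => JE α M i.1 j.1

/-- The spherical harmonics `Y_l^k(θ, φ)`. -/
def Y (l : ℕ) (k : ℤ) (θ φ : ℝ) : ℂ :=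
  ((Real.sin θ ^ k.natAbs : ℝ) : ℂ) * ((p (k.natAbs : ℝ) (l - k.natAbs) (Real.cos θ) : ℝ) : ℂ) *
    Complex.exp (Complex.I * (k : ℂ) * (φ : ℂ))

/-- Parameter region `[0, π] × [0, 2π]` of spherical coordinates. -/
def region : Set (ℝ × ℝ) := Set.Icc (0 : ℝ) Real.pi ×ˢ Set.Icc (0 : ℝ) (2 * Real.pi)

/-- The inner product of `L²(S²)`. -/
def inner2 (f g : ℝ → ℝ → ℂ) : ℂ :=
  (1 / (4 * Real.pi)) *
    ∫ q in region, f q.1 q.2 * (starRingEnd ℂ) (g q.1 q.2) * ((Real.sin q.1 : ℝ) : ℂ)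

/-- The norm of `L²(S²)`. -/
def norm2 (f : ℝ → ℝ → ℂ) : ℝ := Real.sqrt (inner2 f f).re

/-- Membership in `L²(S²)`. -/
def MemL2 (f : ℝ → ℝ → ℂ) : Prop :=
  Measurable (fun q : ℝ × ℝ => f q.1 q.2) ∧
    IntegrableOn (fun q : ℝ × ℝ => ‖f q.1 q.2‖ ^ 2 * Real.sin q.1) region

/-- The multiplication operator `M`. -/
def Mop (f : ℝ → ℝ → ℂ) : ℝ → ℝ → ℂ := fun θ φ => ((Real.cos θ : ℝ) : ℂ) * f θ φ

/-- The power `M^j` of the multiplication operator. -/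
def Mpow (j : ℕ) (f : ℝ → ℝ → ℂ) : ℝ → ℝ → ℂ := fun θ φ => ((Real.cos θ : ℝ) : ℂ) ^ j * f θ φ

/-- The mean value `ε(f)`. -/
def eps (f : ℝ → ℝ → ℂ) : ℝ :=
  (1 / (4 * Real.pi)) * ∫ q in region, Real.cos q.1 * ‖f q.1 q.2‖ ^ 2 * Real.sin q.1

/-- The projection `P_n^m` onto `Π_n^m`. -/
def Pr (n m : ℕ) (f : ℝ → ℝ → ℂ) : ℝ → ℝ → ℂ :=
  fun θ φ => ∑ l ∈ Finset.Icc m n, ∑ k ∈ Finset.Icc (-(l : ℤ)) (l : ℤ),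
    inner2 f (Y l k) * Y l k θ φ

/-- The space–frequency operator `P_n^m M P_n^m`. -/
def SFop (n m : ℕ) (f : ℝ → ℝ → ℂ) : ℝ → ℝ → ℂ := Pr n m (Mop (Pr n m f))

/-- The space `Π_n^m`, spanned by the spherical harmonics `Y_l^k`, `m ≤ l ≤ n`, `|k| ≤ l`. -/
def Pi_nm (n m : ℕ) : Submodule ℂ (ℝ → ℝ → ℂ) :=
  Submodule.span ℂ {g | ∃ l : ℕ, ∃ k : ℤ, m ≤ l ∧ l ≤ n ∧ k.natAbs ≤ l ∧ g = Y l k}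

/-- `N_k = n − max(|k|, m) + 1`. -/
def Nk (n m k : ℕ) : ℕ := n - max k m + 1

/-- The normalizing constant `κ_{k,i}`, given the corresponding root value `xr`. -/
def kap (n m k : ℕ) (xr : ℝ) : ℝ :=
  (Real.sqrt (∑ l ∈ Finset.Icc (max k m) n, (pA (k : ℝ) (m - k) (l - max k m) xr) ^ 2))⁻¹

/-- The eigenfunction `ψ_{k,i}`, given the corresponding root value `xr`. -/
def psiFun (n m : ℕ) (k : ℤ) (xr : ℝ) : ℝ → ℝ → ℂ :=
  fun θ φ => ((kap n m k.natAbs xr : ℝ) : ℂ) *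
    ∑ l ∈ Finset.Icc (max k.natAbs m) n,
      ((pA (k.natAbs : ℝ) (m - k.natAbs) (l - max k.natAbs m) xr : ℝ) : ℂ) * Y l k θ φ

lemma b_pos (k l : ℕ) : 0 < b (k : ℝ) l := by
  cases l with
  | zero =>
    unfold b
    apply Real.sqrt_pos.2
    have h1 : 0 < Real.Gamma ((k : ℝ) + 1) := Real.Gamma_pos_of_pos (by positivity)
    have h2 : 0 < Real.Gamma ((k : ℝ) + 3 / 2) := Real.Gamma_pos_of_pos (by positivity)
    positivity
  | succ l =>
    unfold b
    apply Real.sqrt_pos.2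
    have h : 0 < 2 * ((l : ℝ) + 1) + 2 * (k : ℝ) - 1 := by
      have : (0 : ℝ) ≤ l := by positivity
      have : (0 : ℝ) ≤ k := by positivity
      linarith
    positivity

lemma b_sq (k l : ℕ) : b (k : ℝ) (l + 1) ^ 2 * ((2 * l + 2 * k + 3) * (2 * l + 2 * k + 1)) =
    ((l : ℝ) + 1) * (l + 1 + 2 * k) := by
  unfold b
  have h : 0 < 2 * ((l : ℝ) + 1) + 2 * (k : ℝ) - 1 := by
    have : (0 : ℝ) ≤ l := by positivity
    have : (0 : ℝ) ≤ k := by positivity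
    linarith
  rw [Real.sq_sqrt (by positivity)]
  have e : ((2 * l + 2 * k + 3) * (2 * l + 2 * k + 1) : ℝ) =
      ((2 * ((l : ℝ) + 1) + 2 * k + 1) * (2 * ((l : ℝ) + 1) + 2 * k - 1)) := by ring
  rw [e, div_mul_cancel₀ _ (by positivity)]

/-- three-term recurrence -/
lemma pA_rec0 (k s : ℕ) (x : ℝ) : b k (s + 1) * pA k s 1 x = x * pA k s 0 x := by
  have := (b_pos k (s+1)).ne'
  simp only [pA]
  field_simp

lemma pA_rec (k s l : ℕ) (x : ℝ) :
    b k (s + l + 2) * pA k s (l + 2) x = x * pA k s (l + 1) x - b k (s + l + 1) * pA k s l x := by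
  have := (b_pos k (s+l+2)).ne'
  simp only [pA]
  field_simp

lemma pA_zero_ne (k s : ℕ) (x : ℝ) : pA k s 0 x ≠ 0 := by
  have := (b_pos k s).ne'
  simp only [pA]
  positivity

/-- polynomial version -/
def PP (k : ℕ) : ℕ → Polynomial ℝ
  | 0 => Polynomial.C (1 / b k 0)
  | 1 => Polynomial.C (1 / b k 1) * (Polynomial.X * Polynomial.C (1 / b k 0))
  | l + 2 => Polynomial.C (1 / b k (l + 2)) *
      (Polynomial.X * PP k (l + 1) - Polynomial.C (b k (l + 1)) * PP k l)

lemma PP_eval (k l : ℕ) (x : ℝ) : (PP k l).eval x = p k l x := by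
  unfold p
  induction l using Nat.strong_induction_on with
  | _ l ih =>
    match l, ih with
    | 0, _ => simp [PP, pA]
    | 1, _ => simp [PP, pA]; ring
    | l + 2, ih =>
      simp only [PP, pA, Polynomial.eval_mul, Polynomial.eval_C, Polynomial.eval_sub,
        Polynomial.eval_X, ih (l + 1) (by omega), ih l (by omega), Nat.zero_add]
      ring

lemma PP_rec0 (k : ℕ) (x : ℝ) : b k 1 * (PP k 1).eval x = x * (PP k 0).eval x := by
  rw [PP_eval, PP_eval]; exact pA_rec0 k 0 x

lemma PP_rec (k l : ℕ) (x : ℝ) : b k (l + 2) * (PP k (l + 2)).eval x =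
    x * (PP k (l + 1)).eval x - b k (l + 1) * (PP k l).eval x := by
  simp only [PP_eval]; simpa [p] using pA_rec k 0 l x

lemma dPP_rec0 (k : ℕ) (x : ℝ) :
    b k 1 * (Polynomial.derivative (PP k 1)).eval x = (PP k 0).eval x := by
  have := (b_pos k 1).ne'
  simp [PP, Polynomial.derivative_mul]; field_simp

lemma dPP_rec (k l : ℕ) (x : ℝ) : b k (l + 2) * (Polynomial.derivative (PP k (l + 2))).eval x =
    (PP k (l + 1)).eval x + x * (Polynomial.derivative (PP k (l + 1))).eval x
      - b k (l + 1) * (Polynomial.derivative (PP k l)).eval x := by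
  have := (b_pos k (l+2)).ne'
  simp [PP, Polynomial.derivative_mul]; field_simp

lemma PP_SU (k l : ℕ) (x : ℝ) :
    (1 - x ^ 2) * (Polynomial.derivative (PP k (l + 1))).eval x =
      -((l : ℝ) + 1) * x * (PP k (l + 1)).eval x
        + (2 * l + 2 * k + 3) * b k (l + 1) * (PP k l).eval x ∧
    (1 - x ^ 2) * (Polynomial.derivative (PP k l)).eval x =
      ((l : ℝ) + 2 * k + 1) * x * (PP k l).eval x
        - (2 * l + 2 * k + 1) * b k (l + 1) * (PP k (l + 1)).eval x := by
  induction l with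
  | zero =>
    have h0 := PP_rec0 k x
    have hd := dPP_rec0 k x
    have hb := b_sq k 0
    have hdz : (Polynomial.derivative (PP k 0)).eval x = 0 := by simp [PP]
    have hne := (b_pos k 1).ne'
    have hk : (2 * (k : ℝ) + 1) ≠ 0 := by positivity
    constructor
    · apply mul_left_cancel₀ hne
      apply mul_left_cancel₀ hk
      push_cast at *
      simp only [zero_add] at *
      linear_combination (1 - x^2) * (2 * (k : ℝ) + 1) * hd + (2 * (k : ℝ) + 1) * x * h0
        - (PP k 0).eval x * hb
    · rw [hdz]
      push_cast
      simp only [zero_add]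
      linear_combination (2 * (k : ℝ) + 1) * h0
  | succ l ih =>
    obtain ⟨S, U⟩ := ih
    have h0 := PP_rec k l x
    have hd := dPP_rec k l x
    have hb := b_sq k (l + 1)
    have hb0 := b_sq k l
    have hne := (b_pos k (l + 2)).ne'
    have hk : (2 * (l : ℝ) + 2 * (k : ℝ) + 3) ≠ 0 := by positivity
    push_cast at *
    have U' : (1 - x ^ 2) * (Polynomial.derivative (PP k (l + 1))).eval x =
      ((l : ℝ) + 1 + 2 * k + 1) * x * (PP k (l + 1)).eval x
        - (2 * (l + 1) + 2 * k + 1) * b k (l + 2) * (PP k (l + 2)).eval x := by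
      linear_combination S + (2 * (l : ℝ) + 2 * k + 3) * h0
    refine ⟨?_, U'⟩
    apply mul_left_cancel₀ hne
    apply mul_left_cancel₀ hk
    have hd' : b (k : ℝ) (l + 1 + 1) = b k (l + 2) := rfl
    have hd'' : (PP k (l + 1 + 1)) = PP k (l + 2) := rfl
    rw [hd'] at *
    rw [hd'']
    linear_combination (1 - x^2) * (2 * (l : ℝ) + 2 * k + 3) * hd + 
      (2 * (l : ℝ) + 2 * k + 3) * x * S - (2 * (l : ℝ) + 2 * k + 3) * b k (l + 1) * U
      + (2 * (l : ℝ) + 2 * k + 3) * (l + 2) * x * h0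
      - (PP k (l+1)).eval x * hb + (PP k (l+1)).eval x * hb0

lemma PP_ode (k l : ℕ) (x : ℝ) (hx : 1 - x ^ 2 ≠ 0) :
    (2 * k + 2) * x * (Polynomial.derivative (PP k (l + 1))).eval x -
      (1 - x ^ 2) * (Polynomial.derivative (Polynomial.derivative (PP k (l + 1)))).eval x =
    (l + 1) * (l + 2 + 2 * k) * (PP k (l + 1)).eval x := by
  have hS : (1 - Polynomial.X ^ 2) * (Polynomial.derivative (PP k (l + 1))) =
      Polynomial.C (-((l : ℝ) + 1)) * Polynomial.X * (PP k (l + 1))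
        + Polynomial.C ((2 * l + 2 * k + 3) * b k (l + 1)) * (PP k l) := by
    apply Polynomial.funext
    intro y
    simpa only [Polynomial.eval_mul, Polynomial.eval_add, Polynomial.eval_sub, Polynomial.eval_one,
      Polynomial.eval_pow, Polynomial.eval_X, Polynomial.eval_C] using (PP_SU k l y).1
  have hS2 := congrArg (fun q => (Polynomial.derivative q).eval x) hS
  simp only [Polynomial.derivative_mul, Polynomial.derivative_add, Polynomial.derivative_sub,
    Polynomial.derivative_one, Polynomial.derivative_X_pow, Polynomial.derivative_X,
    Polynomial.derivative_C, Polynomial.eval_mul, Polynomial.eval_add, Polynomial.eval_sub,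
    Polynomial.eval_one, Polynomial.eval_zero,
      Polynomial.eval_pow, Polynomial.eval_X, Polynomial.eval_C] at hS2
  obtain ⟨S, U⟩ := PP_SU k l x
  have hb := b_sq k l
  apply mul_left_cancel₀ hx
  norm_num at hS2
  linear_combination -(1 - x^2) * hS2 - (2 * (l : ℝ) + 2 * k + 3) * b k (l + 1) * U
      + ((l : ℝ) + 1 + 2 * k) * x * S
      + (PP k (l+1)).eval x * hb

/-- the radial inner product -/
def A (k : ℕ) (q : ℝ → ℝ) : ℝ := (1 / 2) * ∫ θ in (0 : ℝ)..Real.pi,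
  Real.sin θ ^ (2 * k + 1) * q (Real.cos θ)

lemma p_cont (k l : ℕ) : Continuous (p k l) := by
  have : p k l = fun x => (PP k l).eval x := by
    funext x; rw [PP_eval]
  rw [this]
  exact (PP k l).continuous

lemma A_zero (k l : ℕ) : A k (p k (l + 1)) = 0 := by
  have key : ∫ θ in (0 : ℝ)..Real.pi,
      ((l : ℝ) + 1) * (l + 2 + 2 * k) * (Real.sin θ ^ (2 * k + 1) * p k (l + 1) (Real.cos θ)) =
      (fun θ : ℝ => Real.sin θ ^ (2 * k + 2) *
        (Polynomial.derivative (PP k (l + 1))).eval (Real.cos θ)) Real.pi -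
      (fun θ : ℝ => Real.sin θ ^ (2 * k + 2) *
        (Polynomial.derivative (PP k (l + 1))).eval (Real.cos θ)) 0 := by
    refine intervalIntegral.integral_eq_sub_of_hasDerivAt_of_le (f := fun θ : ℝ =>
      Real.sin θ ^ (2 * k + 2) * (Polynomial.derivative (PP k (l + 1))).eval (Real.cos θ))
      Real.pi_pos.le ?_ ?_ ?_
    · apply Continuous.continuousOn
      have := (Polynomial.derivative (PP k (l + 1))).continuous
      fun_prop
    · intro θ hθ
      have hs : 0 < Real.sin θ := Real.sin_pos_of_mem_Ioo hθ
      have h1 := (Real.hasDerivAt_sin θ).pow (2 * k + 2)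
      have h2 := ((Polynomial.derivative (PP k (l + 1))).hasDerivAt (Real.cos θ)).comp θ
        (Real.hasDerivAt_cos θ)
      refine (h1.mul h2).congr_deriv ?_
      have hsc := Real.sin_sq_add_cos_sq θ
      have hw : 1 - Real.cos θ ^ 2 = Real.sin θ ^ 2 := by linarith
      have ode := PP_ode k l (Real.cos θ) (by rw [hw]; positivity)
      rw [hw] at ode
      rw [← PP_eval]
      have : 2 * k + 2 - 1 = 2 * k + 1 := by omega
      simp only [this, Function.comp, Pi.pow_apply]
      push_cast
      linear_combination Real.sin θ ^ (2 * k + 1) * ode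
    · apply Continuous.intervalIntegrable
      have := p_cont k (l + 1)
      fun_prop
  rw [intervalIntegral.integral_const_mul] at key
  simp only [Real.sin_pi, Real.sin_zero] at key
  rw [zero_pow (by omega), zero_mul, zero_mul, sub_zero] at key
  have hne : ((l : ℝ) + 1) * (l + 2 + 2 * k) ≠ 0 := by positivity
  unfold A
  rw [(mul_eq_zero.1 key).resolve_left hne, mul_zero]

lemma sin_int (k : ℕ) : ∫ θ in (0 : ℝ)..Real.pi, Real.sin θ ^ (2 * k + 1) =
    Real.sqrt Real.pi * Real.Gamma (k + 1) / Real.Gamma (k + 3 / 2) := by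
  have hpi : Real.sqrt Real.pi ≠ 0 := (Real.sqrt_pos.2 Real.pi_pos).ne'
  rw [integral_sin_pow_odd]
  induction k with
  | zero =>
    have h : Real.Gamma (3 / 2) = 1 / 2 * Real.sqrt Real.pi := by
      rw [show (3 / 2 : ℝ) = 1 / 2 + 1 by norm_num, Real.Gamma_add_one (by norm_num),
        Real.Gamma_one_half_eq]
    simp [h]
    field_simp
  | succ k ih =>
    rw [Finset.prod_range_succ, ← mul_assoc, ih]
    push_cast
    rw [show (k : ℝ) + 1 + 3 / 2 = (k + 3 / 2) + 1 by ring,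
      Real.Gamma_add_one (s := (k : ℝ) + 1) (by positivity),
      Real.Gamma_add_one (s := (k : ℝ) + 3 / 2) (by positivity)]
    have h2 : Real.Gamma ((k : ℝ) + 3 / 2) ≠ 0 := (Real.Gamma_pos_of_pos (by positivity)).ne'
    have h3 : (k : ℝ) + 3 / 2 ≠ 0 := by positivity
    field_simp

lemma A_one (k : ℕ) : A k (fun x => p k 0 x * p k 0 x) = 1 := by
  unfold A
  simp only [p, pA]
  rw [intervalIntegral.integral_mul_const, sin_int]
  have h2 : 0 < Real.Gamma ((k : ℝ) + 3 / 2) := (Real.Gamma_pos_of_pos (by positivity))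
  have h1 : 0 < Real.Gamma ((k : ℝ) + 1) := (Real.Gamma_pos_of_pos (by positivity))
  have hp := Real.sqrt_pos.2 Real.pi_pos
  have hb : b k 0 ^ 2 = Real.sqrt Real.pi * Real.Gamma (k + 1) / (2 * Real.Gamma (k + 3 / 2)) := by
    unfold b
    rw [Real.sq_sqrt (by positivity)]
  have e : 1 / b (k : ℝ) 0 * (1 / b k 0) = (b k 0 ^ 2)⁻¹ := by
    rw [pow_two, mul_inv]; simp
  rw [e, hb]
  field_simp

lemma A_add (k : ℕ) (f g : ℝ → ℝ) (hf : Continuous f) (hg : Continuous g) (c d : ℝ) :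
    A k (fun x => c * f x + d * g x) = c * A k f + d * A k g := by
  unfold A
  have : ∀ θ : ℝ, Real.sin θ ^ (2 * k + 1) * (c * f (Real.cos θ) + d * g (Real.cos θ)) =
    c * (Real.sin θ ^ (2 * k + 1) * f (Real.cos θ)) +
      d * (Real.sin θ ^ (2 * k + 1) * g (Real.cos θ)) := by intro θ; ring
  simp only [this]
  rw [intervalIntegral.integral_add, intervalIntegral.integral_const_mul,
    intervalIntegral.integral_const_mul]
  · ring
  · apply Continuous.intervalIntegrable; fun_prop
  · apply Continuous.intervalIntegrable; fun_prop

lemma A_addm (k : ℕ) {f f' g g' : ℝ → ℝ} (hf : Continuous f) (hf' : Continuous f')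
    (hg : Continuous g) (hg' : Continuous g') (c d : ℝ) :
    A k (fun x => c * (f x * f' x) + d * (g x * g' x)) =
      c * A k (fun x => f x * f' x) + d * A k (fun x => g x * g' x) :=
  A_add k _ _ (Continuous.mul hf hf') (Continuous.mul hg hg') (c := c) (d := d)

/-- uniform recurrence: `x p_l = b_{l+1} p_{l+1} + b_l p_{l-1}` -/
def pm (k : ℕ) : ℕ → ℝ → ℝ
  | 0, _ => 0
  | l + 1, x => b k (l + 1) * p k l x

lemma pm_cont (k l : ℕ) : Continuous (pm k l) := by
  cases l with
  | zero => exact continuous_const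
  | succ l => exact continuous_const.mul (p_cont k l)

lemma p_recU (k l : ℕ) (x : ℝ) : x * p k l x = b k (l + 1) * p k (l + 1) x + pm k l x := by
  cases l with
  | zero => 
    have := pA_rec0 k 0 x
    simp only [p, pm, Nat.zero_add] at *
    linarith
  | succ l =>
    have := pA_rec k 0 l x
    simp only [p, pm, Nat.zero_add] at *
    linarith

lemma A_orth (k i j : ℕ) : A k (fun x => p k j x * p k i x) = if j = i then 1 else 0 := by
  induction j using Nat.strong_induction_on generalizing i with
  | _ j ih =>
    match j, ih with
    | 0, _ =>
      cases i with
      | zero => simpa using A_one k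
      | succ i =>
        have h : (fun x => p k 0 x * p k (i + 1) x) =
            fun x => (1 / b k 0) * p k (i + 1) x + 0 * p k (i + 1) x := by
          funext x; simp [p, pA]
        rw [h, A_add _ _ _ (p_cont _ _) (p_cont _ _), A_zero]; simp
    | j + 1, ih =>
      have ci := p_cont k i
      have hne := (b_pos k (j + 1)).ne'
      have key : A k (fun x => b k (j + 1) * (p k (j + 1) x * p k i x) +
            1 * (pm k j x * p k i x)) = 
          A k (fun x => b k (i + 1) * (p k j x * p k (i + 1) x) + 1 * (p k j x * pm k i x)) := by
        congr 1
        funext x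
        linear_combination (-p k i x) * p_recU k j x + p k j x * p_recU k i x
      rw [A_addm _ (p_cont _ _) ci (pm_cont _ _) ci,
        A_addm _ (p_cont _ _) (p_cont _ _) (p_cont _ _) (pm_cont _ _),
        ih j (by omega)] at key
      have h1 : A k (fun x => pm k j x * p k i x) = if j = i + 1 then b k j else 0 := by
        cases j with
        | zero => simp [pm, A]
        | succ j =>
          have : (fun x => pm k (j + 1) x * p k i x) =
            fun x => b k (j + 1) * (p k j x * p k i x) + 0 * (p k j x * p k i x) := by
            funext x; simp [pm]; ring
          rw [this, A_addm _ (p_cont _ _) ci (p_cont _ _) ci, ih j (by omega)]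
          by_cases h : j = i <;> simp [h]
      have h2 : A k (fun x => p k j x * pm k i x) = if j + 1 = i then b k i else 0 := by
        cases i with
        | zero => simp [pm, A]
        | succ i =>
          have : (fun x => p k j x * pm k (i + 1) x) =
            fun x => b k (i + 1) * (p k j x * p k i x) + 0 * (p k j x * p k i x) := by
            funext x; simp [pm]; ring
          have ci := p_cont k i
          rw [this, A_addm _ (p_cont _ _) ci (p_cont _ _) ci, ih j (by omega)]
          by_cases h : j = i <;> simp [h]
      rw [h1, h2] at key
      apply mul_left_cancel₀ hne
      by_cases e1 : j = i + 1
      · subst e1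
        have hh : i + 1 + 1 ≠ i := by omega
        simp [hh] at key ⊢
        exact key
      · simp only [e1, if_false] at key
        by_cases e2 : j + 1 = i
        · subst e2; simp at key ⊢; linarith
        · simp [e2] at key ⊢; exact key

lemma pA_CD (k s N : ℕ) (x y : ℝ) :
    (x - y) * ∑ j ∈ range (N + 1), pA k s j x * pA k s j y =
      b k (s + N + 1) * (pA k s (N + 1) x * pA k s N y - pA k s N x * pA k s (N + 1) y) := by
  induction N with
  | zero =>
    rw [sum_range_one]
    have hx := pA_rec0 k s x
    have hy := pA_rec0 k s y
    simp only [add_zero, zero_add]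
    linear_combination (-pA k s 0 y) * hx + pA k s 0 x * hy
  | succ N ih =>
    rw [sum_range_succ, mul_add, ih]
    have hx := pA_rec k s N x
    have hy := pA_rec k s N y
    rw [show s + (N + 1) + 1 = s + N + 2 by omega, show N + 1 + 1 = N + 2 by omega]
    linear_combination (-pA k s (N + 1) y) * hx + pA k s (N + 1) x * hy

lemma sum_Icc_range {R : Type*} [AddCommMonoid R] (M n : ℕ) (h : M ≤ n) (f : ℕ → R) :
    ∑ l ∈ Icc M n, f l = ∑ j ∈ range (n - M + 1), f (M + j) := by
  rw [show Icc M n = Ico M (n + 1) by ext; simp, sum_Ico_eq_sum_range]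
  congr 2; omega

/-- coefficients of the eigenvectors -/
def cc (n m : ℕ) (x : ℕ → ℕ → ℝ) (k i j : ℕ) : ℝ :=
  kap n m k (x k i) * pA k (m - k) j (x k i)

lemma kap_eq (n m k : ℕ) (hk : k ≤ n) (hmn : m ≤ n) (y : ℝ) : kap n m k y =
    (Real.sqrt (∑ j ∈ range (Nk n m k), pA k (m - k) j y ^ 2))⁻¹ := by
  unfold kap Nk
  rw [sum_Icc_range _ _ (max_le hk hmn)]
  simp

lemma cc_rows (n m : ℕ) (hmn : m ≤ n) (x : ℕ → ℕ → ℝ) (k : ℕ) (hk : k ≤ n)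
    (hroot : ∀ i < Nk n m k, pA (k : ℝ) (m - k) (Nk n m k) (x k i) = 0)
    (hinj : ∀ i < Nk n m k, ∀ j < Nk n m k, x k i = x k j → i = j)
    (i i' : ℕ) (hi : i < Nk n m k) (hi' : i' < Nk n m k) :
    ∑ j ∈ range (Nk n m k), cc n m x k i j * cc n m x k i' j = if i = i' then 1 else 0 := by
  have e : ∑ j ∈ range (Nk n m k), cc n m x k i j * cc n m x k i' j =
      kap n m k (x k i) * kap n m k (x k i') *
      ∑ j ∈ range (Nk n m k), pA k (m - k) j (x k i) * pA k (m - k) j (x k i') := by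
    rw [mul_sum]
    apply sum_congr rfl
    intros
    unfold cc
    ring
  rw [e]
  by_cases h : i = i'
  · subst h
    rw [if_pos rfl, kap_eq n m k hk hmn]
    set S := ∑ j ∈ range (Nk n m k), pA k (m - k) j (x k i) ^ 2 with hS
    have hpos : 0 < S := by
      apply sum_pos'
      · intros; positivity
      · refine ⟨0, by simp [Nk], ?_⟩
        have := pA_zero_ne k (m - k) (x k i)
        positivity
    have : ∑ j ∈ range (Nk n m k), pA k (m - k) j (x k i) * pA k (m - k) j (x k i) = S := by
      rw [hS]; apply sum_congr rfl; intros; ring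
    rw [this]
    have h2 := Real.mul_self_sqrt hpos.le
    have h3 := (Real.sqrt_pos.2 hpos).ne'
    rw [← mul_inv, h2, inv_mul_cancel₀ hpos.ne']
  · rw [if_neg h]
    have hne : x k i - x k i' ≠ 0 := fun hh => h (hinj i hi i' hi' (sub_eq_zero.1 hh))
    have := pA_CD k (m - k) (n - max k m) (x k i) (x k i')
    have r1 := hroot i hi
    have r2 := hroot i' hi'
    unfold Nk at *
    rw [r1, r2] at this
    simp only [zero_mul, mul_zero, sub_zero] at this
    rw [(mul_eq_zero.1 this).resolve_left hne, mul_zero]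

lemma cc_cols (n m : ℕ) (hmn : m ≤ n) (x : ℕ → ℕ → ℝ) (k : ℕ) (hk : k ≤ n)
    (hroot : ∀ i < Nk n m k, pA (k : ℝ) (m - k) (Nk n m k) (x k i) = 0)
    (hinj : ∀ i < Nk n m k, ∀ j < Nk n m k, x k i = x k j → i = j)
    (j j' : ℕ) (hj : j < Nk n m k) (hj' : j' < Nk n m k) :
    ∑ i ∈ range (Nk n m k), cc n m x k i j * cc n m x k i j' = if j = j' then 1 else 0 := by
  let Q : Matrix (Fin (Nk n m k)) (Fin (Nk n m k)) ℝ := Matrix.of fun i j => cc n m x k i j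
  have h1 : Q * Q.transpose = 1 := by
    ext i i'
    rw [Matrix.mul_apply, Matrix.one_apply]
    have := cc_rows n m hmn x k hk hroot hinj i i' i.2 i'.2
    rw [← Fin.sum_univ_eq_sum_range (fun j => cc n m x k i j * cc n m x k i' j)] at this
    simpa [Fin.ext_iff, Q, Matrix.transpose_apply] using this
  have h2 : Q.transpose * Q = 1 := mul_eq_one_comm.1 h1
  have := congrFun (congrFun h2 ⟨j, hj⟩) ⟨j', hj'⟩
  rw [Matrix.mul_apply, Matrix.one_apply] at this
  rw [← Fin.sum_univ_eq_sum_range (fun i => cc n m x k i j * cc n m x k i j')]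
  simpa [Fin.ext_iff, Q, Matrix.transpose_apply] using this

lemma JE_symm (α : ℝ) (s i j : ℕ) : JE α s i j = JE α s j i := by
  unfold JE
  by_cases h1 : i + 1 = j
  · subst h1
    rw [if_pos rfl, if_neg (by omega), if_pos rfl]
  · by_cases h2 : j + 1 = i
    · subst h2
      rw [if_pos rfl, if_neg (by omega), if_pos rfl]
    · simp [h1, h2]

lemma JE_sum (α : ℝ) (s j N : ℕ) (hj : j < N) (v : ℕ → ℝ) (hv : v N = 0) :
    ∑ i ∈ range N, JE α s i j * v i =
      (if j = 0 then 0 else b α (s + j) * v (j - 1)) + b α (s + j + 1) * v (j + 1) := by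
  have e : ∀ i, JE α s i j * v i = (if i + 1 = j then b α (s + j) * v (j - 1) else 0) +
      (if i = j + 1 then b α (s + j + 1) * v (j + 1) else 0) := by
    intro i
    unfold JE
    by_cases h1 : i + 1 = j
    · subst h1
      rw [if_pos rfl, if_pos rfl, if_neg (by omega)]
      simp [add_assoc]
    · by_cases h2 : i = j + 1
      · subst h2
        simp [h1]
      · have h3 : ¬ (j + 1 = i) := fun h => h2 h.symm
        simp [h1, h2, h3]
  simp only [e]
  rw [sum_add_distrib]
  congr 1
  · cases j with
    | zero => simp
    | succ j =>
      simp only [add_left_inj]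
      rw [sum_ite_eq' (range N) j, if_pos (mem_range.2 (by omega))]
      simp
  · rw [sum_ite_eq' (range N) (j + 1)]
    by_cases h : j + 1 < N
    · simp [h]
    · have : j + 1 = N := by omega
      simp [this, hv]

lemma cc_eig (n m : ℕ) (x : ℕ → ℕ → ℝ) (k : ℕ)
    (hroot : ∀ i < Nk n m k, pA (k : ℝ) (m - k) (Nk n m k) (x k i) = 0)
    (i j : ℕ) (hi : i < Nk n m k) (hj : j < Nk n m k) :
    ∑ j' ∈ range (Nk n m k), JE k (m - k) j' j * cc n m x k i j' = x k i * cc n m x k i j := by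
  rw [JE_sum _ _ _ _ hj _ (by simp [cc, hroot i hi])]
  unfold cc
  cases j with
  | zero =>
    have := pA_rec0 k (m - k) (x k i)
    simp only [add_zero, zero_add, if_true]
    linear_combination kap n m k (x k i) * this
  | succ j =>
    have := pA_rec k (m - k) j (x k i)
    rw [if_neg (by omega)]
    rw [show m - k + (j + 1) + 1 = m - k + j + 2 by omega, show j + 1 - 1 = j by omega,
      show j + 1 + 1 = j + 2 by omega, show m - k + (j + 1) = m - k + j + 1 by omega]
    linear_combination kap n m k (x k i) * this

lemma cc_spec (n m : ℕ) (hmn : m ≤ n) (x : ℕ → ℕ → ℝ) (k : ℕ) (hk : k ≤ n)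
    (hroot : ∀ i < Nk n m k, pA (k : ℝ) (m - k) (Nk n m k) (x k i) = 0)
    (hinj : ∀ i < Nk n m k, ∀ j < Nk n m k, x k i = x k j → i = j)
    (j j' : ℕ) (hj : j < Nk n m k) (hj' : j' < Nk n m k) :
    ∑ i ∈ range (Nk n m k), x k i * cc n m x k i j * cc n m x k i j' = JE k (m - k) j j' := by
  calc ∑ i ∈ range (Nk n m k), x k i * cc n m x k i j * cc n m x k i j'
      = ∑ i ∈ range (Nk n m k), ∑ j'' ∈ range (Nk n m k),
          JE k (m - k) j'' j * (cc n m x k i j'' * cc n m x k i j') := by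
        apply sum_congr rfl
        intro i hi
        rw [← cc_eig n m x k hroot i j (mem_range.1 hi) hj, sum_mul]
        apply sum_congr rfl
        intros; ring
    _ = ∑ j'' ∈ range (Nk n m k), JE k (m - k) j'' j * (if j'' = j' then 1 else 0) := by
        rw [sum_comm]
        apply sum_congr rfl
        intro j'' hj''
        rw [← mul_sum, cc_cols n m hmn x k hk hroot hinj j'' j' (mem_range.1 hj'') hj']
    _ = JE k (m - k) j j' := by
        simp only [mul_ite, mul_one, mul_zero]
        rw [sum_ite_eq' (range (Nk n m k)) j', if_pos (mem_range.2 hj'), JE_symm]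

lemma region_compact : IsCompact region := isCompact_Icc.prod isCompact_Icc

lemma region_meas : MeasurableSet region := measurableSet_Icc.prod measurableSet_Icc

/-- continuity of the uncurried function -/
def Cn (f : ℝ → ℝ → ℂ) : Prop := Continuous (fun q : ℝ × ℝ => f q.1 q.2)

/-- functions with integrable products against continuous functions -/
def Good (f : ℝ → ℝ → ℂ) : Prop := ∀ g, Cn g → IntegrableOn
  (fun q : ℝ × ℝ => f q.1 q.2 * (starRingEnd ℂ) (g q.1 q.2) * ((Real.sin q.1 : ℝ) : ℂ)) region

lemma Cn.good {f : ℝ → ℝ → ℂ} (hf : Cn f) : Good f := by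
  intro g hg
  unfold Cn at *
  apply ContinuousOn.integrableOn_compact region_compact
  apply Continuous.continuousOn
  have h2 : Continuous (fun q : ℝ × ℝ => (starRingEnd ℂ) (g q.1 q.2)) :=
    Complex.continuous_conj.comp hg
  fun_prop

lemma MemL2.good {f : ℝ → ℝ → ℂ} (hf : MemL2 f) : Good f := by
  intro g hg
  obtain ⟨hm, hi⟩ := hf
  unfold Cn at hg
  obtain ⟨D, hD⟩ := region_compact.exists_bound_of_continuousOn hg.continuousOn
  have hc : IntegrableOn (fun q : ℝ × ℝ => Real.sin q.1) region := by
    apply ContinuousOn.integrableOn_compact region_compact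
    fun_prop
  have hdom : IntegrableOn (fun q : ℝ × ℝ => D * (‖f q.1 q.2‖ ^ 2 * Real.sin q.1 + Real.sin q.1))
      region := (hi.add hc).const_mul D
  refine Integrable.mono' hdom ?_ ?_
  · apply Measurable.aestronglyMeasurable
    have h2 : Measurable (fun q : ℝ × ℝ => (starRingEnd ℂ) (g q.1 q.2)) :=
      (Complex.continuous_conj.comp hg).measurable
    have h3 : Measurable (fun q : ℝ × ℝ => ((Real.sin q.1 : ℝ) : ℂ)) := by
      apply Continuous.measurable; fun_prop
    exact (hm.mul h2).mul h3
  · refine (ae_restrict_iff' region_meas).2 (Filter.Eventually.of_forall ?_)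
    intro q hq
    have hs : 0 ≤ Real.sin q.1 := Real.sin_nonneg_of_mem_Icc hq.1
    have hg' := hD q hq
    have hD0 : 0 ≤ D := (norm_nonneg _).trans hg'
    rw [norm_mul, norm_mul, RCLike.norm_conj, Complex.norm_real, Real.norm_of_nonneg hs]
    have h1 : ‖f q.1 q.2‖ ≤ ‖f q.1 q.2‖ ^ 2 + 1 := by nlinarith [sq_nonneg (‖f q.1 q.2‖ - 1)]
    calc ‖f q.1 q.2‖ * ‖g q.1 q.2‖ * Real.sin q.1 ≤ (‖f q.1 q.2‖ ^ 2 + 1) * D * Real.sin q.1 := by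
          gcongr
      _ = _ := by ring

lemma inner2_sum_left {ι : Type*} (s : Finset ι) (a : ι → ℂ) (F : ι → ℝ → ℝ → ℂ)
    (hF : ∀ t ∈ s, Good (F t)) (g : ℝ → ℝ → ℂ) (hg : Cn g) :
    inner2 (fun θ φ => ∑ t ∈ s, a t * F t θ φ) g = ∑ t ∈ s, a t * inner2 (F t) g := by
  unfold inner2
  have : ∀ q : ℝ × ℝ, (∑ t ∈ s, a t * F t q.1 q.2) * (starRingEnd ℂ) (g q.1 q.2) *
      ((Real.sin q.1 : ℝ) : ℂ) = ∑ t ∈ s, a t * (F t q.1 q.2 * (starRingEnd ℂ) (g q.1 q.2) *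
      ((Real.sin q.1 : ℝ) : ℂ)) := by
    intro q; rw [sum_mul, sum_mul]; apply sum_congr rfl; intros; ring
  simp only [this]
  rw [integral_finsetSum _ (fun t ht => (hF t ht g hg).const_mul (a t)), mul_sum]
  apply sum_congr rfl
  intro t _
  rw [integral_const_mul]
  ring

lemma inner2_sum_right {ι : Type*} (s : Finset ι) (a : ι → ℂ) (G : ι → ℝ → ℝ → ℂ)
    (hG : ∀ t ∈ s, Cn (G t)) (f : ℝ → ℝ → ℂ) (hf : Good f) :
    inner2 f (fun θ φ => ∑ t ∈ s, a t * G t θ φ) =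
      ∑ t ∈ s, (starRingEnd ℂ) (a t) * inner2 f (G t) := by
  unfold inner2
  have : ∀ q : ℝ × ℝ, f q.1 q.2 * (starRingEnd ℂ) (∑ t ∈ s, a t * G t q.1 q.2) *
      ((Real.sin q.1 : ℝ) : ℂ) = ∑ t ∈ s, (starRingEnd ℂ) (a t) *
      (f q.1 q.2 * (starRingEnd ℂ) (G t q.1 q.2) * ((Real.sin q.1 : ℝ) : ℂ)) := by
    intro q; rw [map_sum, mul_sum, sum_mul]; apply sum_congr rfl; intros; rw [map_mul]; ring
  simp only [this]
  rw [integral_finsetSum _ (fun t ht => (hf (G t) (hG t ht)).const_mul _), mul_sum]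
  apply sum_congr rfl
  intro t _
  rw [integral_const_mul]
  ring

lemma Cn_sum {ι : Type*} (s : Finset ι) (a : ι → ℂ) (F : ι → ℝ → ℝ → ℂ)
    (hF : ∀ t ∈ s, Cn (F t)) : Cn (fun θ φ => ∑ t ∈ s, a t * F t θ φ) := by
  unfold Cn at *
  exact continuous_finsetSum _ (fun t ht => continuous_const.mul (hF t ht))

lemma Cn_Y (l : ℕ) (k : ℤ) : Cn (Y l k) := by
  unfold Cn Y
  have := p_cont k.natAbs (l - k.natAbs)
  fun_prop

lemma Cn_MY (l : ℕ) (k : ℤ) : Cn (Mop (Y l k)) := by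
  have := Cn_Y l k
  unfold Cn Mop at *
  fun_prop

lemma exp_int (d : ℤ) : ∫ φ in Set.Icc (0 : ℝ) (2 * Real.pi),
    Complex.exp (Complex.I * (d : ℂ) * (φ : ℂ)) = if d = 0 then (2 * Real.pi : ℂ) else 0 := by
  rw [integral_Icc_eq_integral_Ioc, ← intervalIntegral.integral_of_le (by positivity)]
  split_ifs with h
  · subst h; simp
  · have hc : Complex.I * (d : ℂ) ≠ 0 := mul_ne_zero Complex.I_ne_zero (by exact_mod_cast h)
    rw [integral_exp_mul_complex hc]
    have : Complex.exp (Complex.I * (d : ℂ) * ((2 * Real.pi : ℝ) : ℂ)) = 1 := by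
      rw [Complex.exp_eq_one_iff]
      exact ⟨d, by push_cast; ring⟩
    rw [this]; simp

lemma inner2_sep (u v : ℝ → ℝ) (k k' : ℤ) :
    inner2 (fun θ φ => (u θ : ℂ) * Complex.exp (Complex.I * (k : ℂ) * (φ : ℂ)))
      (fun θ φ => (v θ : ℂ) * Complex.exp (Complex.I * (k' : ℂ) * (φ : ℂ))) =
    if k = k' then (((1 / 2) * ∫ θ in (0 : ℝ)..Real.pi, u θ * v θ * Real.sin θ : ℝ) : ℂ) else 0 := by
  unfold inner2
  have : ∀ q : ℝ × ℝ, (u q.1 : ℂ) * Complex.exp (Complex.I * (k : ℂ) * (q.2 : ℂ)) *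
      (starRingEnd ℂ) ((v q.1 : ℂ) * Complex.exp (Complex.I * (k' : ℂ) * (q.2 : ℂ))) *
      ((Real.sin q.1 : ℝ) : ℂ) = ((u q.1 * v q.1 * Real.sin q.1 : ℝ) : ℂ) *
        Complex.exp (Complex.I * ((k - k' : ℤ) : ℂ) * (q.2 : ℂ)) := by
    intro q
    have h : Complex.exp (Complex.I * ((k - k' : ℤ) : ℂ) * (q.2 : ℂ)) =
      Complex.exp (Complex.I * (k : ℂ) * (q.2 : ℂ)) *
        (starRingEnd ℂ) (Complex.exp (Complex.I * (k' : ℂ) * (q.2 : ℂ))) := by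
      rw [← Complex.exp_conj, ← Complex.exp_add]
      congr 1
      simp
      ring
    rw [h, map_mul, Complex.conj_ofReal]
    push_cast
    ring
  simp only [this]
  unfold region
  rw [Measure.volume_eq_prod, setIntegral_prod_mul
    (fun θ : ℝ => ((u θ * v θ * Real.sin θ : ℝ) : ℂ))
    (fun φ : ℝ => Complex.exp (Complex.I * ((k - k' : ℤ) : ℂ) * (φ : ℂ))), exp_int,
    integral_Icc_eq_integral_Ioc, ← intervalIntegral.integral_of_le Real.pi_pos.le,
    intervalIntegral.integral_ofReal]
  by_cases h : k = k'
  · have hpi : (Real.pi : ℂ) ≠ 0 := by exact_mod_cast Real.pi_ne_zero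
    simp only [h, sub_self, if_true]
    push_cast
    field_simp
    ring
  · simp [h, sub_eq_zero]

lemma inner_YY (l l' : ℕ) (k k' : ℤ) (h : k.natAbs ≤ l) (h' : k'.natAbs ≤ l') :
    inner2 (Y l k) (Y l' k') = if k = k' ∧ l = l' then 1 else 0 := by
  have e : ∀ (l : ℕ) (k : ℤ), Y l k = fun (θ φ : ℝ) =>
      ((Real.sin θ ^ k.natAbs * p (k.natAbs : ℝ) (l - k.natAbs) (Real.cos θ) : ℝ) : ℂ) *
      Complex.exp (Complex.I * (k : ℂ) * (φ : ℂ)) := by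
    intro l k; funext θ φ; unfold Y; push_cast; ring
  rw [e, e, inner2_sep]
  by_cases hk : k = k'
  · subst hk
    have ha := A_orth k.natAbs (l' - k.natAbs) (l - k.natAbs)
    unfold A at ha
    have e2 : ∀ θ, Real.sin θ ^ k.natAbs * p (k.natAbs : ℝ) (l - k.natAbs) (Real.cos θ) *
        (Real.sin θ ^ k.natAbs * p (k.natAbs : ℝ) (l' - k.natAbs) (Real.cos θ)) * Real.sin θ =
        Real.sin θ ^ (2 * k.natAbs + 1) * (p (k.natAbs : ℝ) (l - k.natAbs) (Real.cos θ) *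
         p (k.natAbs : ℝ) (l' - k.natAbs) (Real.cos θ)) := by intro θ; ring
    simp only [e2, if_true, true_and]
    rw [ha]
    by_cases hl : l = l'
    · simp [hl]
    · have : l - k.natAbs ≠ l' - k.natAbs := by omega
      simp [hl, this]
  · simp [hk]

lemma A_JE (k a c s j j' : ℕ) (ha : a = s + j) (hc : c = s + j') :
    A k (fun x => x * p k a x * p k c x) = JE k s j j' := by
  have h1 : A k (fun x => x * p k a x * p k c x) =
      (if a + 1 = c then b k c else 0) + (if c + 1 = a then b k a else 0) := by
    have e : (fun x => x * p k a x * p k c x) = fun x => b k (a + 1) * (p k (a + 1) x * p k c x) +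
        1 * (pm k a x * p k c x) := by
      funext x; rw [p_recU]; ring
    rw [e, A_addm _ (p_cont _ _) (p_cont _ _) (pm_cont _ _) (p_cont _ _), A_orth]
    have e2 : A k (fun x => pm k a x * p k c x) = if c + 1 = a then b k a else 0 := by
      cases a with
      | zero => simp [pm, A]
      | succ a =>
        have : (fun x => pm k (a + 1) x * p k c x) =
          fun x => b k (a + 1) * (p k a x * p k c x) + 0 * (p k a x * p k c x) := by
          funext x; simp [pm]; ring
        rw [this, A_addm _ (p_cont _ _) (p_cont _ _) (p_cont _ _) (p_cont _ _), A_orth]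
        by_cases h : c = a
        · simp [h]
        · have : a ≠ c := fun hh => h hh.symm
          simp [h, this]
    rw [e2, one_mul]
    congr 1
    by_cases h : a + 1 = c <;> simp [h]
  rw [h1]
  unfold JE
  by_cases e1 : j + 1 = j'
  · have : a + 1 = c := by omega
    have h2 : ¬ (c + 1 = a) := by omega
    rw [if_pos this, if_neg h2, if_pos e1, add_zero]
    congr 1; omega
  · have h3 : ¬ (a + 1 = c) := by omega
    rw [if_neg h3, if_neg e1]
    by_cases e2 : j' + 1 = j
    · have : c + 1 = a := by omega
      rw [if_pos this, if_pos e2, zero_add]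
      congr 1; omega
    · have : ¬ (c + 1 = a) := by omega
      rw [if_neg this, if_neg e2, zero_add]

lemma inner_MYY (m j j' : ℕ) (k k' : ℤ) :
    inner2 (Mop (Y (max k.natAbs m + j) k)) (Y (max k'.natAbs m + j') k') =
      if k = k' then ((JE k.natAbs (m - k.natAbs) j j' : ℝ) : ℂ) else 0 := by
  have e : ∀ (l : ℕ) (k : ℤ), Y l k = fun (θ φ : ℝ) =>
      ((Real.sin θ ^ k.natAbs * p (k.natAbs : ℝ) (l - k.natAbs) (Real.cos θ) : ℝ) : ℂ) *
      Complex.exp (Complex.I * (k : ℂ) * (φ : ℂ)) := by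
    intro l k; funext θ φ; unfold Y; push_cast; ring
  have eM : ∀ (l : ℕ) (k : ℤ), Mop (Y l k) = fun (θ φ : ℝ) =>
      ((Real.cos θ * (Real.sin θ ^ k.natAbs * p (k.natAbs : ℝ) (l - k.natAbs) (Real.cos θ)) : ℝ) : ℂ)
      * Complex.exp (Complex.I * (k : ℂ) * (φ : ℂ)) := by
    intro l k; funext θ φ; unfold Mop; rw [e]; push_cast; ring
  rw [eM, e, inner2_sep]
  by_cases hk : k = k'
  · subst hk
    have ha := A_JE k.natAbs (max k.natAbs m + j - k.natAbs) (max k.natAbs m + j' - k.natAbs)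
      (m - k.natAbs) j j' (by omega) (by omega)
    unfold A at ha
    simp only [if_true]
    rw [← ha]
    congr 3
    funext θ
    ring
  · simp [hk]

lemma psi_eq (n m : ℕ) (hmn : m ≤ n) (x : ℕ → ℕ → ℝ) (k : ℤ) (hk : k.natAbs ≤ n) (i : ℕ) :
    psiFun n m k (x k.natAbs i) = fun θ φ => ∑ j ∈ range (Nk n m k.natAbs),
      (cc n m x k.natAbs i j : ℂ) * Y (max k.natAbs m + j) k θ φ := by
  funext θ φ
  unfold psiFun cc Nk
  rw [sum_Icc_range _ _ (max_le hk hmn), mul_sum]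
  apply sum_congr rfl
  intro j _
  rw [Nat.add_sub_cancel_left]
  push_cast
  ring

lemma psi_smul (n m : ℕ) (hmn : m ≤ n) (x : ℕ → ℕ → ℝ) (k : ℤ) (hk : k.natAbs ≤ n) (i : ℕ) :
    psiFun n m k (x k.natAbs i) = ∑ j ∈ range (Nk n m k.natAbs),
      (cc n m x k.natAbs i j : ℂ) • Y (max k.natAbs m + j) k := by
  rw [psi_eq n m hmn x k hk]
  funext θ φ
  simp [Finset.sum_apply]

lemma Y_psi (n m : ℕ) (hmn : m ≤ n) (x : ℕ → ℕ → ℝ) (k : ℤ) (hk : k.natAbs ≤ n) (j : ℕ)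
    (hj : j < Nk n m k.natAbs)
    (hroot : ∀ i < Nk n m k.natAbs,
      pA (k.natAbs : ℝ) (m - k.natAbs) (Nk n m k.natAbs) (x k.natAbs i) = 0)
    (hinj : ∀ i < Nk n m k.natAbs, ∀ j < Nk n m k.natAbs, x k.natAbs i = x k.natAbs j → i = j) :
    Y (max k.natAbs m + j) k = ∑ i ∈ range (Nk n m k.natAbs),
      (cc n m x k.natAbs i j : ℂ) • psiFun n m k (x k.natAbs i) := by
  simp only [psi_smul n m hmn x k hk, smul_sum, smul_smul]
  rw [sum_comm]
  simp only [← sum_smul]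
  have : ∀ j' ∈ range (Nk n m k.natAbs), (∑ i ∈ range (Nk n m k.natAbs),
      (cc n m x k.natAbs i j : ℂ) * (cc n m x k.natAbs i j' : ℂ)) • Y (max k.natAbs m + j') k =
      if j = j' then Y (max k.natAbs m + j') k else 0 := by
    intro j' hj'
    have := cc_cols n m hmn x k.natAbs hk hroot hinj j j' hj (mem_range.1 hj')
    have h2 := congrArg (fun r : ℝ => (r : ℂ)) this
    simp only [Complex.ofReal_sum, Complex.ofReal_mul] at h2
    rw [h2]
    by_cases h : j = j' <;> simp [h]
  rw [sum_congr rfl this, sum_ite_eq, if_pos (mem_range.2 hj)]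

lemma psi_orth (n m : ℕ) (hmn : m ≤ n) (x : ℕ → ℕ → ℝ) (k k' : ℤ) (hk : k.natAbs ≤ n)
    (hk' : k'.natAbs ≤ n) (i i' : ℕ) (hi : i < Nk n m k.natAbs) (hi' : i' < Nk n m k'.natAbs)
    (hroot : ∀ i < Nk n m k.natAbs,
      pA (k.natAbs : ℝ) (m - k.natAbs) (Nk n m k.natAbs) (x k.natAbs i) = 0)
    (hinj : ∀ i < Nk n m k.natAbs, ∀ j < Nk n m k.natAbs, x k.natAbs i = x k.natAbs j → i = j) :
    inner2 (psiFun n m k (x k.natAbs i)) (psiFun n m k' (x k'.natAbs i')) =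
          if k = k' ∧ i = i' then 1 else 0 := by
  rw [psi_eq n m hmn x k hk, psi_eq n m hmn x k' hk',
    inner2_sum_left _ _ _ (fun _ _ => (Cn_Y _ _).good) _ (Cn_sum _ _ _ (fun _ _ => Cn_Y _ _))]
  have : ∀ j, inner2 (Y (max k.natAbs m + j) k) (fun θ φ => ∑ j' ∈ range (Nk n m k'.natAbs),
      (cc n m x k'.natAbs i' j' : ℂ) * Y (max k'.natAbs m + j') k' θ φ) =
      ∑ j' ∈ range (Nk n m k'.natAbs), if k = k' ∧ j' = j then (cc n m x k'.natAbs i' j : ℂ)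
        else 0 := by
    intro j
    rw [inner2_sum_right _ _ _ (fun _ _ => Cn_Y _ _) _ (Cn_Y _ _).good]
    apply sum_congr rfl
    intro j' _
    rw [inner_YY _ _ _ _ (by omega) (by omega), Complex.conj_ofReal]
    by_cases h : k = k'
    · subst h
      by_cases hj : j' = j
      · simp [hj]
      · have : j ≠ j' := fun h => hj h.symm
        simp [hj, this]
    · simp [h]
  simp only [this]
  by_cases h : k = k'
  · subst h
    have := cc_rows n m hmn x k.natAbs hk hroot hinj i i' hi hi'
    have h2 := congrArg (fun r : ℝ => (r : ℂ)) this
    simp only [Complex.ofReal_sum, Complex.ofReal_mul] at h2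
    simp only [true_and]
    rw [show (if i = i' then (1 : ℂ) else 0) = ((if i = i' then 1 else 0 : ℝ) : ℂ) by
      split_ifs <;> simp, ← h2]
    apply sum_congr rfl
    intro j hj
    rw [sum_ite_eq', if_pos hj]
  · simp [h]

lemma reindex {R : Type*} [AddCommMonoid R] (n m : ℕ) (hmn : m ≤ n) (F : ℕ → ℤ → R) :
    ∑ l ∈ Icc m n, ∑ k ∈ Icc (-(l : ℤ)) (l : ℤ), F l k =
    ∑ k ∈ Icc (-(n : ℤ)) (n : ℤ), ∑ j ∈ range (Nk n m k.natAbs), F (max k.natAbs m + j) k := by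
  rw [sum_comm' (t' := Icc (-(n : ℤ)) (n : ℤ)) (s' := fun k => Icc (max k.natAbs m) n)]
  · apply sum_congr rfl
    intro k hk
    have hkn : k.natAbs ≤ n := by have := mem_Icc.1 hk; omega
    rw [sum_Icc_range _ _ (max_le hkn hmn)]
    rfl
  · intro l k
    simp only [mem_Icc]
    omega

lemma SFop_eq (n m : ℕ) (hmn : m ≤ n) (f : ℝ → ℝ → ℂ) (θ φ : ℝ) :
    SFop n m f θ φ = ∑ k ∈ Icc (-(n : ℤ)) (n : ℤ), ∑ j' ∈ range (Nk n m k.natAbs),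
      (∑ j ∈ range (Nk n m k.natAbs), inner2 f (Y (max k.natAbs m + j) k) *
        ((JE k.natAbs (m - k.natAbs) j j' : ℝ) : ℂ)) * Y (max k.natAbs m + j') k θ φ := by
  have hP : Mop (Pr n m f) = fun θ φ => ∑ k ∈ Icc (-(n : ℤ)) (n : ℤ), (1 : ℂ) *
      (fun (k : ℤ) (θ φ : ℝ) => ∑ j ∈ range (Nk n m k.natAbs),
      inner2 f (Y (max k.natAbs m + j) k) * Mop (Y (max k.natAbs m + j) k) θ φ) k θ φ := by
    funext θ φ
    unfold Mop Pr
    rw [reindex n m hmn (fun l k => inner2 f (Y l k) * Y l k θ φ), mul_sum]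
    apply sum_congr rfl
    intro k _
    rw [mul_sum, one_mul]
    apply sum_congr rfl
    intro j _
    ring
  have hc : ∀ k : ℤ, Cn (fun (θ φ : ℝ) => ∑ j ∈ range (Nk n m k.natAbs),
      inner2 f (Y (max k.natAbs m + j) k) * Mop (Y (max k.natAbs m + j) k) θ φ) :=
    fun k => Cn_sum _ _ _ (fun _ _ => Cn_MY _ _)
  unfold SFop
  rw [hP]
  unfold Pr
  rw [reindex n m hmn]
  apply sum_congr rfl
  intro k' hk'
  apply sum_congr rfl
  intro j' _
  rw [inner2_sum_left _ _ _ (fun k _ => (hc k).good) _ (Cn_Y _ _)]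
  have : ∀ k : ℤ, inner2 (fun (θ φ : ℝ) => ∑ j ∈ range (Nk n m k.natAbs),
      inner2 f (Y (max k.natAbs m + j) k) * Mop (Y (max k.natAbs m + j) k) θ φ)
      (Y (max k'.natAbs m + j') k') = if k = k' then ∑ j ∈ range (Nk n m k.natAbs),
        inner2 f (Y (max k.natAbs m + j) k) * ((JE k.natAbs (m - k.natAbs) j j' : ℝ) : ℂ) else 0 := by
    intro k
    rw [inner2_sum_left _ _ _ (fun j _ => (Cn_MY _ _).good) _ (Cn_Y _ _)]
    simp only [inner_MYY]
    by_cases h : k = k' <;> simp [h]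
  simp only [this, one_mul]
  rw [sum_ite_eq', if_pos hk']

lemma finrank_Pi (n m : ℕ) (hmn : m ≤ n) :
    Module.finrank ℂ (Pi_nm n m) = (n + 1) ^ 2 - m ^ 2 := by
  let s : Finset (Σ _ : ℕ, ℤ) := (Icc m n).sigma (fun l => Icc (-(l : ℤ)) (l : ℤ))
  let v : s → (ℝ → ℝ → ℂ) := fun t => Y t.1.1 t.1.2
  have hs : ∀ t : s, m ≤ t.1.1 ∧ t.1.1 ≤ n ∧ t.1.2.natAbs ≤ t.1.1 := by
    intro t
    have h2 := t.2
    simp only [s, mem_sigma, mem_Icc] at h2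
    omega
  have hv : LinearIndependent ℂ v := by
    rw [Fintype.linearIndependent_iff]
    intro g hg t0
    have h0 : (fun θ φ => ∑ t : s, g t * v t θ φ) = 0 := by
      rw [← hg]; funext θ φ; simp [Finset.sum_apply]
    have h1 := inner2_sum_left univ g v (fun t _ => (Cn_Y _ _).good) (v t0) (Cn_Y _ _)
    rw [h0] at h1
    have hz : inner2 0 (v t0) = 0 := by simp [inner2]
    rw [hz] at h1
    have h2 : ∀ t, inner2 (v t) (v t0) = if t = t0 then 1 else 0 := by
      intro t
      simp only [v]
      rw [inner_YY _ _ _ _ (hs t).2.2 (hs t0).2.2]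
      have : (t.1.2 = t0.1.2 ∧ t.1.1 = t0.1.1) ↔ t = t0 := by
        constructor
        · rintro ⟨a, b⟩
          apply Subtype.ext
          exact Sigma.ext b (heq_of_eq a)
        · rintro rfl; exact ⟨rfl, rfl⟩
      simp [this]
    simp only [h2] at h1
    simpa using h1.symm
  have hr : Pi_nm n m = Submodule.span ℂ (Set.range v) := by
    unfold Pi_nm
    congr 1
    ext g
    constructor
    · rintro ⟨l, k, h1, h2, h3, rfl⟩
      refine ⟨⟨⟨l, k⟩, ?_⟩, rfl⟩
      simp only [s, mem_sigma, mem_Icc]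
      omega
    · rintro ⟨t, rfl⟩
      exact ⟨t.1.1, t.1.2, (hs t).1, (hs t).2.1, (hs t).2.2, rfl⟩
  rw [hr, finrank_span_eq_card hv, Fintype.card_coe]
  simp only [s, card_sigma, Int.card_Icc]
  have e : ∀ l : ℕ, ((l : ℤ) + 1 - -(l : ℤ)).toNat = 2 * l + 1 := by intro l; omega
  simp only [e]
  have : ∀ d, ∑ l ∈ Icc m (m + d), (2 * l + 1) + m ^ 2 = (m + d + 1) ^ 2 := by
    intro d
    induction d with
    | zero => simp; ring
    | succ d ih =>
      rw [← add_assoc, sum_Icc_succ_top (by omega)]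
      linarith [ih]
  obtain ⟨d, rfl⟩ := Nat.exists_eq_add_of_le hmn
  have := this d
  omega

/-- given an enumeration `x k i` of the roots of the relevant (associated)
ultraspherical polynomials, the family `ψ_{k,i}` is an orthonormal basis of the
`N_n^m`-dimensional space `Π_n^m`, and `P_n^m M P_n^m` has the stated spectral
decomposition. -/
theorem stmt9 (n m : ℕ) (hmn : m ≤ n) (x : ℕ → ℕ → ℝ)
    (hroot : ∀ k : ℕ, k ≤ n → ∀ i < Nk n m k, pA (k : ℝ) (m - k) (Nk n m k) (x k i) = 0)
    (hinj : ∀ k : ℕ, k ≤ n → ∀ i < Nk n m k, ∀ j < Nk n m k, x k i = x k j → i = j) :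
    (∀ k k' : ℤ, k.natAbs ≤ n → k'.natAbs ≤ n →
      ∀ i < Nk n m k.natAbs, ∀ i' < Nk n m k'.natAbs,
        inner2 (psiFun n m k (x k.natAbs i)) (psiFun n m k' (x k'.natAbs i')) =
          if k = k' ∧ i = i' then 1 else 0) ∧
    Pi_nm n m = Submodule.span ℂ
      {g | ∃ k : ℤ, ∃ i : ℕ, k.natAbs ≤ n ∧ i < Nk n m k.natAbs ∧
        g = psiFun n m k (x k.natAbs i)} ∧
    Module.finrank ℂ (Pi_nm n m) = (n + 1) ^ 2 - m ^ 2 ∧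
    (∀ f : ℝ → ℝ → ℂ, MemL2 f → ∀ θ φ : ℝ,
      SFop n m f θ φ =
        ∑ k ∈ Finset.Icc (-(n : ℤ)) (n : ℤ), ∑ i ∈ Finset.range (Nk n m k.natAbs),
          ((x k.natAbs i : ℝ) : ℂ) * inner2 f (psiFun n m k (x k.natAbs i)) *
            psiFun n m k (x k.natAbs i) θ φ) := by
  have hr : ∀ k : ℤ, k.natAbs ≤ n → ∀ i < Nk n m k.natAbs,
      pA (k.natAbs : ℝ) (m - k.natAbs) (Nk n m k.natAbs) (x k.natAbs i) = 0 :=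
    fun k hk => hroot k.natAbs hk
  have hi : ∀ k : ℤ, k.natAbs ≤ n → ∀ i < Nk n m k.natAbs, ∀ j < Nk n m k.natAbs,
      x k.natAbs i = x k.natAbs j → i = j := fun k hk => hinj k.natAbs hk
  refine ⟨?_, ?_, finrank_Pi n m hmn, ?_⟩
  · intro k k' hk hk' i hin i' hin'
    exact psi_orth n m hmn x k k' hk hk' i i' hin hin' (hr k hk) (hi k hk)
  · apply le_antisymm
    · unfold Pi_nm
      rw [Submodule.span_le]
      rintro g ⟨l, k, hml, hln, hkl, rfl⟩
      have hkn : k.natAbs ≤ n := hkl.trans hln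
      obtain ⟨j, rfl⟩ := Nat.exists_eq_add_of_le (max_le hkl hml)
      have hj : j < Nk n m k.natAbs := by unfold Nk; omega
      rw [Y_psi n m hmn x k hkn j hj (hr k hkn) (hi k hkn)]
      apply Submodule.sum_mem
      intro i hin
      apply Submodule.smul_mem
      apply Submodule.subset_span
      exact ⟨k, i, hkn, mem_range.1 hin, rfl⟩
    · rw [Submodule.span_le]
      rintro g ⟨k, i, hkn, hin, rfl⟩
      rw [psi_smul n m hmn x k hkn]
      apply Submodule.sum_mem
      intro j hj
      apply Submodule.smul_mem
      apply Submodule.subset_span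
      have := mem_range.1 hj
      unfold Nk at this
      exact ⟨max k.natAbs m + j, k, by omega, by omega, by omega, rfl⟩
  · intro f hf θ φ
    rw [SFop_eq n m hmn f θ φ]
    apply sum_congr rfl
    intro k hk
    have hkn : k.natAbs ≤ n := by have := mem_Icc.1 hk; omega
    have hfg := hf.good
    have e1 : ∀ i, inner2 f (psiFun n m k (x k.natAbs i)) =
        ∑ j ∈ range (Nk n m k.natAbs), (cc n m x k.natAbs i j : ℂ) *
          inner2 f (Y (max k.natAbs m + j) k) := by
      intro i
      rw [psi_eq n m hmn x k hkn, inner2_sum_right _ _ _ (fun _ _ => Cn_Y _ _) _ hfg]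
      simp only [Complex.conj_ofReal]
    have e2 : ∀ i, psiFun n m k (x k.natAbs i) θ φ =
        ∑ j ∈ range (Nk n m k.natAbs), (cc n m x k.natAbs i j : ℂ) *
          Y (max k.natAbs m + j) k θ φ := by
      intro i
      rw [psi_eq n m hmn x k hkn]
    simp only [e1, e2]
    have e3 : ∀ i, (x k.natAbs i : ℂ) * (∑ j ∈ range (Nk n m k.natAbs),
        (cc n m x k.natAbs i j : ℂ) * inner2 f (Y (max k.natAbs m + j) k)) *
        (∑ j ∈ range (Nk n m k.natAbs), (cc n m x k.natAbs i j : ℂ) *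
          Y (max k.natAbs m + j) k θ φ) =
        ∑ j' ∈ range (Nk n m k.natAbs), ∑ j ∈ range (Nk n m k.natAbs),
          (inner2 f (Y (max k.natAbs m + j) k) * Y (max k.natAbs m + j') k θ φ) *
          ((x k.natAbs i * cc n m x k.natAbs i j * cc n m x k.natAbs i j' : ℝ) : ℂ) := by
      intro i
      rw [mul_sum]
      apply sum_congr rfl
      intro j' _
      rw [mul_sum, sum_mul]
      apply sum_congr rfl
      intro j _
      push_cast
      ring
    simp only [e3]
    rw [sum_comm]
    apply sum_congr rfl
    intro j' hj'
    rw [sum_comm, sum_mul]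
    apply sum_congr rfl
    intro j hj
    rw [← mul_sum, ← Complex.ofReal_sum, cc_spec n m hmn x k.natAbs hkn (hr k hkn) (hi k hkn) j j'
      (mem_range.1 hj) (mem_range.1 hj')]
    ring
end SFT
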